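/- arXiv:2104.10426 — 2 statements merged into one kernel-verified Lean document; each statement's English description precedes it below -/
import Mathlib

section
/- For every reduced fluid solution, every i ∈ {1,…,N} and every t ≥ 0, the Lyapunov function G_i defined by (p_{1,i}/μ_i)·G_i(t) = m^c_i Q̄_{c,i}(t) + τ_i Q̄_{u,i}(t) + Σ_j m_{j,i}·( p_{1,i} Q̄_{u,j}(t) + Q̄_{j,i}(t) ) satisfies the identity (p_{1,i}/μ_i)·G_i(t) = (p_{1,i}/μ_i)·G_i(0) − B̄_i(t) + ρ_i·t, where B̄_i(t) := T̄_{c,i}(t) + T̄_{u,i}(t) + Σ_j T̄_{j,i}(t) is the cumulative busy time of queue i. -/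
open MeasureTheory Set

/-- The data of a speculative queueing network: a probability space carrying the
service requirements `η₁, η₂`, arrival rate `lam`, service rates `μ`, timeouts `τ`,
and routing probability vectors `p0, p1`. -/
structure SpecModel (N : ℕ) (Ω : Type*) [MeasurableSpace Ω] where
  P : Measure Ω
  probP : IsProbabilityMeasure P
  η₁ : Ω → ℝ
  η₂ : Ω → ℝ
  meas₁ : Measurable η₁
  meas₂ : Measurable η₂
  int₁ : Integrable η₁ P
  int₂ : Integrable η₂ P
  nonneg₁ : ∀ ω, 0 ≤ η₁ ω
  nonneg₂ : ∀ ω, 0 ≤ η₂ ω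
  lam : ℝ
  lam_pos : 0 < lam
  μ : Fin N → ℝ
  μ_pos : ∀ i, 0 < μ i
  τ : Fin N → ℝ
  τ_pos : ∀ i, 0 < τ i
  p0 : Fin N → ℝ
  p1 : Fin N → ℝ
  p0_nonneg : ∀ i, 0 ≤ p0 i
  p0_sum : ∑ i, p0 i = 1
  p1_pos : ∀ i, 0 < p1 i
  p1_sum : ∑ i, p1 i = 1
  q_pos : ∀ i, 0 < (P {ω | η₁ ω ≤ μ i * τ i}).toReal
  q_lt_one : ∀ i, (P {ω | η₁ ω ≤ μ i * τ i}).toReal < 1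

namespace SpecModel

variable {N : ℕ} {Ω : Type*} [MeasurableSpace Ω]

/-- `q i = P(η₁ ≤ μ i τ i)`. -/
noncomputable def q (M : SpecModel N Ω) (i : Fin N) : ℝ :=
  (M.P {ω | M.η₁ ω ≤ M.μ i * M.τ i}).toReal

/-- `mc i = E[(η₁/μ i)·1{η₁ ≤ μ i τ i}] / q i`. -/
noncomputable def mc (M : SpecModel N Ω) (i : Fin N) : ℝ :=
  (∫ ω in {ω | M.η₁ ω ≤ M.μ i * M.τ i}, M.η₁ ω / M.μ i ∂M.P) / M.q i

/-- `mm j i = E[(η₂/μ i)·1{η₁ > μ j τ j}] / (1 - q j)`. -/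
noncomputable def mm (M : SpecModel N Ω) (j i : Fin N) : ℝ :=
  (∫ ω in {ω | M.μ j * M.τ j < M.η₁ ω}, M.η₂ ω / M.μ i ∂M.P) / (1 - M.q j)

/-- Nominal load of queue `i`. -/
noncomputable def rho (M : SpecModel N Ω) (i : Fin N) : ℝ :=
  M.lam * N * M.p0 i * (∫ ω, min (M.η₁ ω / M.μ i) (M.τ i) ∂M.P)
    + M.lam * N * ∑ j, M.p0 j * M.p1 i *
        (∫ ω in {ω | M.μ j * M.τ j < M.η₁ ω}, M.η₂ ω / M.μ i ∂M.P)

/-- A reduced fluid solution of the speculative queueing network. -/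
structure FluidSol (M : SpecModel N Ω) where
  Qc : Fin N → ℝ → ℝ
  Qu : Fin N → ℝ → ℝ
  Qm : Fin N → Fin N → ℝ → ℝ
  Tc : Fin N → ℝ → ℝ
  Tu : Fin N → ℝ → ℝ
  Tm : Fin N → Fin N → ℝ → ℝ
  Qc_nonneg : ∀ i t, 0 ≤ t → 0 ≤ Qc i t
  Qu_nonneg : ∀ i t, 0 ≤ t → 0 ≤ Qu i t
  Qm_nonneg : ∀ j i t, 0 ≤ t → 0 ≤ Qm j i t
  Tc_mono : ∀ i, MonotoneOn (Tc i) (Ici 0)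
  Tu_mono : ∀ i, MonotoneOn (Tu i) (Ici 0)
  Tm_mono : ∀ j i, MonotoneOn (Tm j i) (Ici 0)
  Tc_zero : ∀ i, Tc i 0 = 0
  Tu_zero : ∀ i, Tu i 0 = 0
  Tm_zero : ∀ j i, Tm j i 0 = 0
  Tc_nonneg : ∀ i t, 0 ≤ t → 0 ≤ Tc i t
  Tu_nonneg : ∀ i t, 0 ≤ t → 0 ≤ Tu i t
  Tm_nonneg : ∀ j i t, 0 ≤ t → 0 ≤ Tm j i t
  eq_c : ∀ i t, 0 ≤ t →
    Qc i t = Qc i 0 + M.lam * N * M.p0 i * M.q i * t - Tc i t / M.mc i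
  eq_u : ∀ i t, 0 ≤ t →
    Qu i t = Qu i 0 + M.lam * N * M.p0 i * (1 - M.q i) * t - Tu i t / M.τ i
  eq_m : ∀ j i t, 0 ≤ t →
    Qm j i t = Qm j i 0 - Tm j i t / M.mm j i + M.p1 i * Tu j t / M.τ j

/-- The Lyapunov function `G_i`, defined by
`(p1 i / μ i) · G i t = mc i · Qc i t + τ i · Qu i t + ∑ j, mm j i · (p1 i · Qu j t + Qm j i t)`. -/
noncomputable def lyap (M : SpecModel N Ω) (F : FluidSol M) (i : Fin N) (t : ℝ) : ℝ :=
  (M.μ i / M.p1 i) *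
    (M.mc i * F.Qc i t + M.τ i * F.Qu i t
      + ∑ j, M.mm j i * (M.p1 i * F.Qu j t + F.Qm j i t))

/-- The cumulative busy time `B̄_i(t)`. -/
noncomputable def busy (M : SpecModel N Ω) (F : FluidSol M) (i : Fin N) (t : ℝ) : ℝ :=
  F.Tc i t + F.Tu i t + ∑ j, F.Tm j i t

end SpecModel

open SpecModel

theorem SpecModel.aux_min {N : ℕ} {Ω : Type*} [MeasurableSpace Ω]
    (M : SpecModel N Ω) (i : Fin N) :
    ∫ ω, min (M.η₁ ω / M.μ i) (M.τ i) ∂M.P = M.q i * M.mc i + (1 - M.q i) * M.τ i := by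
  haveI := M.probP
  have hμ := M.μ_pos i
  have hq : M.q i ≠ 0 := (M.q_pos i).ne'
  have hA : MeasurableSet {ω | M.η₁ ω ≤ M.μ i * M.τ i} :=
    measurableSet_le M.meas₁ measurable_const
  have hint : Integrable (fun ω => min (M.η₁ ω / M.μ i) (M.τ i)) M.P :=
    (M.int₁.div_const _).inf (integrable_const _)
  rw [← integral_add_compl hA hint]
  have h1 : ∫ ω in {ω | M.η₁ ω ≤ M.μ i * M.τ i}, min (M.η₁ ω / M.μ i) (M.τ i) ∂M.P
      = M.q i * M.mc i := by
    unfold SpecModel.mc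
    rw [mul_div_cancel₀ _ hq]
    apply setIntegral_congr_fun hA
    intro ω hω
    apply min_eq_left
    rw [div_le_iff₀ hμ, mul_comm]
    exact hω
  have h2 : ∫ ω in {ω | M.η₁ ω ≤ M.μ i * M.τ i}ᶜ, min (M.η₁ ω / M.μ i) (M.τ i) ∂M.P
      = (1 - M.q i) * M.τ i := by
    have : ∫ ω in {ω | M.η₁ ω ≤ M.μ i * M.τ i}ᶜ, min (M.η₁ ω / M.μ i) (M.τ i) ∂M.P
        = ∫ ω in {ω | M.η₁ ω ≤ M.μ i * M.τ i}ᶜ, M.τ i ∂M.P := by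
      apply setIntegral_congr_fun hA.compl
      intro ω hω
      apply min_eq_right
      rw [le_div_iff₀ hμ, mul_comm]
      have h' : ¬ (M.η₁ ω ≤ M.μ i * M.τ i) := hω
      exact (not_le.mp h').le
    rw [this, setIntegral_const, probReal_compl_eq_one_sub hA]
    rfl
  rw [h1, h2]

/-- For every reduced fluid solution, every queue `i` and every `t ≥ 0`,
the Lyapunov function `G_i` satisfies
`(p1 i / μ i) * G_i(t) = (p1 i / μ i) * G_i(0) - B̄_i(t) + ρ_i * t`. -/
theorem lyap_identity {N : ℕ} {Ω : Type*} [MeasurableSpace Ω]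
    (M : SpecModel N Ω)
    (hmc : ∀ i, 0 < M.mc i) (hmm : ∀ j i, 0 < M.mm j i)
    (F : SpecModel.FluidSol M) (i : Fin N) (t : ℝ) (ht : 0 ≤ t) :
    (M.p1 i / M.μ i) * SpecModel.lyap M F i t
      = (M.p1 i / M.μ i) * SpecModel.lyap M F i 0
        - SpecModel.busy M F i t + M.rho i * t := by
  have hμ := (M.μ_pos i).ne'
  have hp := (M.p1_pos i).ne'
  have hτ := (M.τ_pos i).ne'
  have hc := (hmc i).ne'
  have key : ∀ x : ℝ, M.p1 i / M.μ i * (M.μ i / M.p1 i * x) = x := by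
    intro x; field_simp
  unfold SpecModel.lyap SpecModel.busy SpecModel.rho
  rw [key, key, SpecModel.aux_min]
  have hsum : ∑ j, M.mm j i * (M.p1 i * F.Qu j t + F.Qm j i t)
      = ∑ j, M.mm j i * (M.p1 i * F.Qu j 0 + F.Qm j i 0) - ∑ j, F.Tm j i t
        + M.lam * N * (∑ j, M.p0 j * M.p1 i *
          (∫ ω in {ω | M.μ j * M.τ j < M.η₁ ω}, M.η₂ ω / M.μ i ∂M.P)) * t := by
    rw [Finset.mul_sum, Finset.sum_mul, ← Finset.sum_sub_distrib, ← Finset.sum_add_distrib]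
    apply Finset.sum_congr rfl
    intro j _
    have hq : 1 - M.q j ≠ 0 := (sub_pos.mpr (M.q_lt_one j)).ne'
    have hI : (∫ ω in {ω | M.μ j * M.τ j < M.η₁ ω}, M.η₂ ω / M.μ i ∂M.P)
        = M.mm j i * (1 - M.q j) := by
      unfold SpecModel.mm
      rw [div_mul_cancel₀ _ hq]
    have hm := (hmm j i).ne'
    have hτj := (M.τ_pos j).ne'
    rw [hI, F.eq_u j t ht, F.eq_m j i t ht]
    field_simp
    ring
  rw [hsum, F.eq_c i t ht, F.eq_u i t ht]
  field_simp
  ring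
end

section
/- For every reduced fluid solution and every t ≥ 0: if 𝒬_i(t) = 0 and 𝒬_s(t) > 0 for indices i ≠ s, then G_i(t) < G_s(t), where G_i is the Lyapunov function defined by (p_{1,i}/μ_i)·G_i(t) = m^c_i Q̄_{c,i}(t) + τ_i Q̄_{u,i}(t) + Σ_j m_{j,i}·( p_{1,i} Q̄_{u,j}(t) + Q̄_{j,i}(t) ) and 𝒬_i(t) := Q̄_{c,i}(t) + Q̄_{u,i}(t) + Σ_j Q̄_{j,i}(t). -/
open MeasureTheory Set

open SpecModel

theorem lyap_decomp_aux {N : ℕ} {Ω : Type*} [MeasurableSpace Ω]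
    (M : SpecModel N Ω) (F : SpecModel.FluidSol M) (i : Fin N) (t : ℝ) :
    SpecModel.lyap M F i t =
      (M.μ i / M.p1 i) * (M.mc i * F.Qc i t + M.τ i * F.Qu i t + ∑ j, M.mm j i * F.Qm j i t)
      + ∑ j, ((∫ ω in {ω | M.μ j * M.τ j < M.η₁ ω}, M.η₂ ω ∂M.P) / (1 - M.q j)) * F.Qu j t := by
  have h1 := (M.p1_pos i).ne'
  have h2 := (M.μ_pos i).ne'
  have key : ∀ j, M.mm j i =
      ((∫ ω in {ω | M.μ j * M.τ j < M.η₁ ω}, M.η₂ ω ∂M.P) / (1 - M.q j)) / M.μ i := by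
    intro j
    unfold SpecModel.mm
    rw [integral_div]
    ring
  have h3 : ∑ j, ((∫ ω in {ω | M.μ j * M.τ j < M.η₁ ω}, M.η₂ ω ∂M.P) / (1 - M.q j)) * F.Qu j t
      = (M.μ i / M.p1 i) * ∑ j, M.mm j i * (M.p1 i * F.Qu j t) := by
    rw [Finset.mul_sum]
    refine Finset.sum_congr rfl fun j _ => ?_
    rw [key j]
    generalize (∫ ω in {ω | M.μ j * M.τ j < M.η₁ ω}, M.η₂ ω ∂M.P) / (1 - M.q j) = K
    field_simp
  rw [h3]
  unfold SpecModel.lyap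
  simp only [mul_add, Finset.sum_add_distrib]
  ring

/-- For every reduced fluid solution and `t ≥ 0`: if queue `i` is empty
(`𝒬_i(t) = 0`) while queue `s ≠ i` is nonempty (`𝒬_s(t) > 0`), then `G_i(t) < G_s(t)`. -/
theorem lyap_lt_of_empty {N : ℕ} {Ω : Type*} [MeasurableSpace Ω]
    (M : SpecModel N Ω)
    (hmc : ∀ i, 0 < M.mc i) (hmm : ∀ j i, 0 < M.mm j i)
    (F : SpecModel.FluidSol M) (i s : Fin N) (his : i ≠ s) (t : ℝ) (ht : 0 ≤ t)
    (hi : F.Qc i t + F.Qu i t + ∑ j, F.Qm j i t = 0)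
    (hs : 0 < F.Qc s t + F.Qu s t + ∑ j, F.Qm j s t) :
    SpecModel.lyap M F i t < SpecModel.lyap M F s t := by
  rw [lyap_decomp_aux, lyap_decomp_aux]
  have hc := F.Qc_nonneg
  have hu := F.Qu_nonneg
  have hm := F.Qm_nonneg
  have hsi : 0 ≤ ∑ j, F.Qm j i t := Finset.sum_nonneg fun j _ => hm j i t ht
  have hss : 0 ≤ ∑ j, F.Qm j s t := Finset.sum_nonneg fun j _ => hm j s t ht
  have e1 : F.Qc i t = 0 := by linarith [hc i t ht, hu i t ht]
  have e2 : F.Qu i t = 0 := by linarith [hc i t ht, hu i t ht]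
  have e3 : ∑ j, F.Qm j i t = 0 := by linarith [hc i t ht, hu i t ht]
  have e4 : ∀ j, F.Qm j i t = 0 := fun j =>
    (Finset.sum_eq_zero_iff_of_nonneg (fun j _ => hm j i t ht)).1 e3 j (Finset.mem_univ j)
  have a1 : 0 ≤ M.mc s * F.Qc s t := mul_nonneg (hmc s).le (hc s t ht)
  have a2 : 0 ≤ M.τ s * F.Qu s t := mul_nonneg (M.τ_pos s).le (hu s t ht)
  have a3' : ∀ j ∈ Finset.univ, 0 ≤ M.mm j s * F.Qm j s t :=
    fun j _ => mul_nonneg (hmm j s).le (hm j s t ht)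
  have a3 : 0 ≤ ∑ j, M.mm j s * F.Qm j s t := Finset.sum_nonneg a3'
  have pos : 0 < M.mc s * F.Qc s t + M.τ s * F.Qu s t + ∑ j, M.mm j s * F.Qm j s t := by
    by_contra hcon
    have b1 : M.mc s * F.Qc s t = 0 := by linarith
    have b2 : M.τ s * F.Qu s t = 0 := by linarith
    have b3 : ∑ j, M.mm j s * F.Qm j s t = 0 := by linarith
    have c1 := (mul_eq_zero.1 b1).resolve_left (hmc s).ne'
    have c2 := (mul_eq_zero.1 b2).resolve_left (M.τ_pos s).ne'
    have c3 : ∑ j, F.Qm j s t = 0 := Finset.sum_eq_zero fun j hj =>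
      (mul_eq_zero.1 ((Finset.sum_eq_zero_iff_of_nonneg a3').1 b3 j hj)).resolve_left (hmm j s).ne'
    linarith
  have := mul_pos (div_pos (M.μ_pos s) (M.p1_pos s)) pos
  simp only [e1, e2, e4, mul_zero, add_zero, Finset.sum_const_zero, zero_add]
  linarith
end
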